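/- arXiv:1712.10330 — 2 statements merged into one kernel-verified Lean document; each statement's English description precedes it below -/
import Mathlib

section
/- Let 0 < α < 1 and define Ψ_α(t) = E_α(-t^α) for t ≥ 0. Then Ψ_α(0) = 1 and for every t > 0 the Caputo fractional derivative of Ψ_α of order α equals -Ψ_α(t), i.e. (1/Γ(1-α)) ∫₀ᵗ Ψ_α'(s) / (t-s)^α ds = -E_α(-t^α). -/
/-- The one-parameter Mittag-Leffler function `E_α(x) = ∑ xⁿ / Γ(αn + 1)`. -/
noncomputable def mittagLeffler (α x : ℝ) : ℝ :=
  ∑' n : ℕ, x ^ n / Real.Gamma (α * n + 1)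

open Set MeasureTheory

/-- Restricting Euler's integral to `(M, ∞)` bounds `Γ (x + 1)` from below. -/
lemma rpow_mul_exp_neg_le_Gamma_add_one {M x : ℝ} (hM : 0 ≤ M) (hx : 0 ≤ x) :
    M ^ x * Real.exp (-M) ≤ Real.Gamma (x + 1) := by
  have hconv := Real.GammaIntegral_convergent (by linarith : 0 < x + 1)
  rw [Real.Gamma_eq_integral (by linarith), ← integral_exp_neg_Ioi, ← integral_const_mul]
  refine le_trans ?_ (setIntegral_mono_set hconv ?_ (Ioi_subset_Ioi hM).eventuallyLE)
  · refine setIntegral_mono_on ((integrableOn_exp_neg_Ioi M).const_mul _)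
      (hconv.mono_set (Ioi_subset_Ioi hM)) measurableSet_Ioi fun y hy => ?_
    rw [add_sub_cancel_right, mul_comm]
    gcongr
    exact (mem_Ioi.mp hy).le
  · filter_upwards [ae_restrict_mem measurableSet_Ioi] with y hy
    exact mul_nonneg (Real.exp_pos _).le (Real.rpow_nonneg (mem_Ioi.mp hy).le _)

lemma summable_pow_div_Gamma {α : ℝ} (hα : 0 < α) (x : ℝ) :
    Summable fun n : ℕ => x ^ n / Real.Gamma (α * n + 1) := by
  set M : ℝ := (2 * (|x| + 1)) ^ (1 / α) with hM
  have hx : 0 < |x| + 1 := by positivity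
  refine Summable.of_norm_bounded (summable_geometric_two.mul_left (Real.exp M)) fun n => ?_
  have hn : 0 ≤ α * n := by positivity
  have hΓ := rpow_mul_exp_neg_le_Gamma_add_one (M := M) (by positivity) hn
  have hpow : M ^ (α * n) = (2 * (|x| + 1)) ^ n := by
    rw [hM, ← Real.rpow_mul (by positivity), ← Real.rpow_natCast]
    congr 1
    field_simp
  have hpos : 0 < Real.Gamma (α * n + 1) := Real.Gamma_pos_of_pos (by linarith)
  rw [hpow, Real.exp_neg, ← div_eq_mul_inv, div_le_iff₀ (Real.exp_pos _)] at hΓ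
  rw [norm_div, norm_pow, Real.norm_eq_abs, Real.norm_of_nonneg hpos.le, div_le_iff₀ hpos]
  calc |x| ^ n ≤ (|x| + 1) ^ n := by gcongr; linarith
    _ = (1 / 2) ^ n * (2 * (|x| + 1)) ^ n := by rw [← mul_pow]; congr 1; ring
    _ ≤ (1 / 2) ^ n * (Real.Gamma (α * n + 1) * Real.exp M) := by gcongr
    _ = _ := by ring

/-- Termwise differentiation of `E_α`, with the coefficients `n / Γ(αn + 1)` simplified. -/
lemma hasDerivAt_mittagLeffler {α : ℝ} (hα : 0 < α) (x : ℝ) :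
    HasDerivAt (mittagLeffler α)
      (α⁻¹ * ∑' n : ℕ, x ^ n / Real.Gamma (α * (n + 1))) x := by
  set R : ℝ := |x| + 1 with hR
  have hR1 : 1 ≤ R := by rw [hR]; linarith [abs_nonneg x]
  have hxR : x ∈ Metric.ball (0 : ℝ) R := by simp [hR]
  have hpos (n : ℕ) : 0 < Real.Gamma (α * n + 1) := Real.Gamma_pos_of_pos (by positivity)
  have hbound (n : ℕ) (y : ℝ) (hy : y ∈ Metric.ball (0 : ℝ) R) :
      ‖n * y ^ (n - 1) / Real.Gamma (α * n + 1)‖ ≤ (2 * R) ^ n / Real.Gamma (α * n + 1) := by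
    have hy' : |y| ≤ R := by simpa using (mem_ball_zero_iff.mp hy).le
    rw [norm_div, Real.norm_of_nonneg (hpos n).le, norm_mul, norm_pow, Real.norm_natCast,
      Real.norm_eq_abs, mul_pow]
    have h2 : (n : ℝ) ≤ 2 ^ n := by exact_mod_cast n.lt_two_pow_self.le
    have h3 : |y| ^ (n - 1) ≤ R ^ n :=
      (pow_le_pow_left₀ (abs_nonneg y) hy' _).trans (pow_le_pow_right₀ hR1 (Nat.sub_le n 1))
    have := hpos n
    gcongr
  have hsum := summable_pow_div_Gamma hα (2 * R)
  have key := hasDerivAt_tsum_of_isPreconnected hsum Metric.isOpen_ball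
    (convex_ball (0 : ℝ) R).isPreconnected
    (fun n y _ => (hasDerivAt_pow n y).div_const (Real.Gamma (α * n + 1))) hbound hxR
    (summable_pow_div_Gamma hα x) hxR
  rw [(Summable.of_norm_bounded hsum fun n => hbound n x hxR).tsum_eq_zero_add] at key
  refine key.congr_deriv (Eq.symm ?_)
  rw [← tsum_mul_left]
  simp only [Nat.cast_zero, zero_mul, zero_div, zero_add]
  refine tsum_congr fun n => ?_
  have hn : α * ((n : ℝ) + 1) ≠ 0 := by positivity
  have hΓ : Real.Gamma (α * (n + 1)) ≠ 0 := (Real.Gamma_pos_of_pos (by positivity)).ne'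
  push_cast
  rw [Real.Gamma_add_one hn]
  field_simp

/-- The Beta integral on `[0, t]`. -/
lemma integral_rpow_mul_sub_rpow {a b t : ℝ} (ha : 0 < a) (hb : 0 < b) (ht : 0 < t) :
    ∫ s in (0 : ℝ)..t, s ^ (a - 1) * (t - s) ^ (b - 1) =
      t ^ (a + b - 1) * (Real.Gamma a * Real.Gamma b / Real.Gamma (a + b)) := by
  have h := Complex.betaIntegral_scaled a b ht
  rw [Complex.betaIntegral_eq_Gamma_mul_div _ _ (by simpa) (by simpa)] at h
  simp_rw [← Complex.ofReal_add, Complex.Gamma_ofReal] at h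
  rw [← Complex.ofReal_inj, ← intervalIntegral.integral_ofReal]
  push_cast [Complex.ofReal_cpow ht.le] at h ⊢
  rw [← h]
  refine intervalIntegral.integral_congr fun s hs => ?_
  rw [uIcc_of_le ht.le] at hs
  simp [Complex.ofReal_cpow hs.1, Complex.ofReal_cpow (sub_nonneg.mpr hs.2)]

lemma intervalIntegrable_rpow_mul_sub_rpow {a b t : ℝ} (ha : 0 < a) (hb : 0 < b) (ht : 0 < t) :
    IntervalIntegrable (fun s => s ^ (a - 1) * (t - s) ^ (b - 1)) volume 0 t := by
  by_contra h
  have h0 := intervalIntegral.integral_undef h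
  rw [integral_rpow_mul_sub_rpow ha hb ht] at h0
  have := Real.Gamma_pos_of_pos ha
  have := Real.Gamma_pos_of_pos hb
  have := Real.Gamma_pos_of_pos (add_pos ha hb)
  have : 0 < t ^ (a + b - 1) * (Real.Gamma a * Real.Gamma b / Real.Gamma (a + b)) := by positivity
  exact this.ne' h0

lemma deriv_mittagLeffler_neg_rpow {α s : ℝ} (hα : 0 < α) (hs : 0 < s) :
    deriv (fun t => mittagLeffler α (-(t ^ α))) s =
      ∑' n : ℕ, (-1) ^ (n + 1) * s ^ (α * (n + 1) - 1) / Real.Gamma (α * (n + 1)) := by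
  have hpow : HasDerivAt (fun t : ℝ => -(t ^ α)) (-(α * s ^ (α - 1))) s :=
    (Real.hasDerivAt_rpow_const (Or.inl hs.ne')).neg
  have h := (hasDerivAt_mittagLeffler hα (-(s ^ α))).comp s hpow
  simp only [Function.comp_def] at h
  rw [h.deriv, ← tsum_mul_left, ← tsum_mul_right]
  refine tsum_congr fun n => ?_
  have hexp : s ^ (α * (n + 1) - 1) = (s ^ α) ^ n * s ^ (α - 1) := by
    rw [← Real.rpow_natCast (s ^ α), ← Real.rpow_mul hs.le, ← Real.rpow_add hs]
    congr 1
    ring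
  rw [hexp, neg_pow (s ^ α) n]
  field_simp
  ring

/-- For `0 < α < 1`, the function `Ψ_α(t) = E_α(-t^α)` satisfies `Ψ_α(0) = 1` and
the fractional relaxation equation: its Caputo fractional derivative of order `α`,
`(1/Γ(1-α)) ∫₀ᵗ Ψ_α'(s)/(t-s)^α ds`, equals `-Ψ_α(t)` for every `t > 0`. -/
theorem mittagLeffler_caputo_relaxation
    (α : ℝ) (hα0 : 0 < α) (hα1 : α < 1)
    (Ψ : ℝ → ℝ) (hΨ : ∀ t, Ψ t = mittagLeffler α (-(t ^ α))) :
    Ψ 0 = 1 ∧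
    ∀ t : ℝ, 0 < t →
      (1 / Real.Gamma (1 - α)) * ∫ s in (0:ℝ)..t, deriv Ψ s / (t - s) ^ α
        = -mittagLeffler α (-(t ^ α)) := by
  obtain rfl : Ψ = fun t => mittagLeffler α (-(t ^ α)) := funext hΨ
  refine ⟨?_, fun t ht => ?_⟩
  · have h := (hasSum_single (f := fun n : ℕ => (0 : ℝ) ^ n / Real.Gamma (α * n + 1)) 0
      fun n hn => by simp [hn]).tsum_eq
    simpa [mittagLeffler, Real.zero_rpow hα0.ne'] using h
  have hβ : 0 < 1 - α := by linarith
  have hpos (n : ℕ) : 0 < α * ((n : ℝ) + 1) := by positivity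
  have hΓ (n : ℕ) : 0 < Real.Gamma (α * (n + 1)) := Real.Gamma_pos_of_pos (hpos n)
  have hΓβ := Real.Gamma_pos_of_pos hβ
  let K (n : ℕ) (s : ℝ) : ℝ := s ^ (α * (n + 1) - 1) * (t - s) ^ (1 - α - 1)
  have hK (n : ℕ) : (∫ s in Ioc 0 t, K n s) / Real.Gamma (α * (n + 1)) =
      Real.Gamma (1 - α) * ((t ^ α) ^ n / Real.Gamma (α * n + 1)) := by
    rw [← intervalIntegral.integral_of_le ht.le, integral_rpow_mul_sub_rpow (hpos n) hβ ht,
      show α * ((n : ℝ) + 1) + (1 - α) = α * n + 1 by ring, add_sub_cancel_right,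
      Real.rpow_mul ht.le, Real.rpow_natCast]
    have := (hΓ n).ne'
    field_simp
  let F (n : ℕ) (s : ℝ) : ℝ := (-1) ^ (n + 1) / Real.Gamma (α * (n + 1)) * K n s
  have hF_int (n : ℕ) : IntegrableOn (F n) (Ioc 0 t) :=
    ((intervalIntegrable_iff_integrableOn_Ioc_of_le ht.le).mp
      (intervalIntegrable_rpow_mul_sub_rpow (hpos n) hβ ht)).const_mul _
  have hF_norm (n : ℕ) : ∫ s in Ioc 0 t, ‖F n s‖ =
      Real.Gamma (1 - α) * ((t ^ α) ^ n / Real.Gamma (α * n + 1)) := by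
    rw [← hK, div_eq_inv_mul, ← integral_const_mul]
    refine setIntegral_congr_fun measurableSet_Ioc fun s hs => ?_
    have hKs : 0 ≤ K n s :=
      mul_nonneg (Real.rpow_nonneg hs.1.le _) (Real.rpow_nonneg (sub_nonneg.mpr hs.2) _)
    simp [F, abs_of_pos (hΓ n), abs_of_nonneg hKs]
  have hF_sum : Summable fun n => ∫ s in Ioc 0 t, ‖F n s‖ := by
    simp_rw [hF_norm]
    exact (summable_pow_div_Gamma hα0 _).mul_left _
  have hswap := (hasSum_integral_of_summable_integral_norm hF_int hF_sum).tsum_eq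
  have hderiv : ∫ s in (0 : ℝ)..t,
      deriv (fun t => mittagLeffler α (-(t ^ α))) s / (t - s) ^ α =
        ∫ s in Ioc 0 t, ∑' n, F n s := by
    rw [intervalIntegral.integral_of_le ht.le]
    refine setIntegral_congr_fun measurableSet_Ioc fun s hs => ?_
    rw [deriv_mittagLeffler_neg_rpow hα0 hs.1, ← tsum_div_const]
    refine tsum_congr fun n => ?_
    simp only [F, K]
    rw [show 1 - α - 1 = -α by ring, Real.rpow_neg (sub_nonneg.mpr hs.2)]
    ring
  have hF (n : ℕ) : ∫ s in Ioc 0 t, F n s =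
      -Real.Gamma (1 - α) * ((-(t ^ α)) ^ n / Real.Gamma (α * n + 1)) := by
    rw [integral_const_mul, div_mul_eq_mul_div, mul_div_assoc, hK, neg_pow (t ^ α) n]
    ring
  rw [hderiv, ← hswap, tsum_congr hF, tsum_mul_left, mittagLeffler]
  field_simp
end

section
/- Let 0 < α < 1. For every real s > 0, the Laplace transform of Ψ_α(t) = E_α(-t^α) is ∫₀^∞ e^{-st} E_α(-t^α) dt = s^{α-1} / (s^α + 1). -/
open MeasureTheory Set Filter Topology

namespace MittagLeffler

lemma rpow_mul_exp_neg_le_Gamma {R y : ℝ} (hR : 0 < R) (hy : 0 ≤ y) :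
    R ^ y * Real.exp (-R) ≤ Real.Gamma (y + 1) := by
  rw [Real.Gamma_eq_integral (by linarith)]
  have hint := Real.GammaIntegral_convergent (s := y + 1) (by linarith)
  have hexp : IntegrableOn (fun x : ℝ => R ^ y * Real.exp (-x)) (Ioi R) :=
    (integrableOn_exp_neg_Ioi R).const_mul _
  calc R ^ y * Real.exp (-R) = ∫ x in Ioi R, R ^ y * Real.exp (-x) := by
        rw [integral_const_mul, integral_exp_neg_Ioi]
    _ ≤ ∫ x in Ioi R, Real.exp (-x) * x ^ (y + 1 - 1) := by
        refine setIntegral_mono_on hexp (hint.mono_set (Ioi_subset_Ioi hR.le))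
          measurableSet_Ioi fun x hx => ?_
        have hx' : R < x := hx
        rw [mul_comm, add_sub_cancel_right]
        gcongr
    _ ≤ ∫ x in Ioi 0, Real.exp (-x) * x ^ (y + 1 - 1) := by
        refine setIntegral_mono_set hint ?_ (Ioi_subset_Ioi hR.le).eventuallyLE
        filter_upwards [ae_restrict_mem measurableSet_Ioi] with x hx
        have hx' : 0 < x := hx
        positivity

lemma Gamma_pos {α : ℝ} (hα : 0 < α) (n : ℕ) : 0 < Real.Gamma (α * n + 1) :=
  Real.Gamma_pos_of_pos (by positivity)

lemma summable_pow_div_Gamma {α : ℝ} (hα : 0 < α) (x : ℝ) :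
    Summable fun n : ℕ => x ^ n / Real.Gamma (α * n + 1) := by
  set R : ℝ := (2 * (|x| + 1)) ^ α⁻¹
  have hRpos : 0 < R := by positivity
  have hRα : R ^ α = 2 * (|x| + 1) := Real.rpow_inv_rpow (by positivity) hα.ne'
  have hq : |x| / R ^ α < 1 := by
    rw [hRα, div_lt_one (by positivity)]
    linarith [abs_nonneg x]
  refine Summable.of_norm_bounded
    ((summable_geometric_of_lt_one (by positivity) hq).mul_left (Real.exp R)) fun n => ?_
  have h := rpow_mul_exp_neg_le_Gamma hRpos (y := α * n) (by positivity)
  rw [norm_div, norm_pow, Real.norm_eq_abs, Real.norm_of_nonneg (Gamma_pos hα n).le]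
  calc |x| ^ n / Real.Gamma (α * n + 1) ≤ |x| ^ n / (R ^ (α * n) * Real.exp (-R)) := by gcongr
    _ = Real.exp R * (|x| / R ^ α) ^ n := by
        rw [Real.rpow_mul hRpos.le, Real.rpow_natCast, Real.exp_neg, div_pow]
        field_simp

lemma continuous_mittagLeffler {α : ℝ} (hα : 0 < α) : Continuous (mittagLeffler α) := by
  refine continuous_iff_continuousAt.2 fun x => ?_
  have hon : ContinuousOn (mittagLeffler α) (Icc (-(|x| + 1)) (|x| + 1)) := by
    refine continuousOn_tsum (fun n => by fun_prop) (summable_pow_div_Gamma hα (|x| + 1))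
      fun n y hy => ?_
    rw [norm_div, norm_pow, Real.norm_eq_abs, Real.norm_of_nonneg (Gamma_pos hα n).le]
    have := (Gamma_pos hα n).le
    have := abs_le.2 hy
    gcongr
  exact hon.continuousAt (Icc_mem_nhds (by linarith [neg_abs_le x]) (by linarith [le_abs_self x]))

lemma integral_rpow_mul_sub_rpow {u v a : ℝ} (hu : 0 < u) (hv : 0 < v) (ha : 0 < a) :
    ∫ x in (0:ℝ)..a, x ^ (u - 1) * (a - x) ^ (v - 1) =
      a ^ (u + v - 1) * (Real.Gamma u * Real.Gamma v / Real.Gamma (u + v)) := by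
  apply Complex.ofReal_injective
  have h := Complex.betaIntegral_scaled (u : ℂ) (v : ℂ) ha
  rw [Complex.betaIntegral_eq_Gamma_mul_div _ _ (by simpa) (by simpa)] at h
  rw [← intervalIntegral.integral_ofReal]
  push_cast [Complex.ofReal_cpow ha.le, ← Complex.Gamma_ofReal]
  rw [← h]
  refine intervalIntegral.integral_congr fun x hx => ?_
  rw [uIcc_of_le ha.le] at hx
  rw [Complex.ofReal_cpow hx.1, Complex.ofReal_cpow (sub_nonneg.2 hx.2)]
  push_cast
  rfl

lemma intervalIntegrable_sub_rpow {α : ℝ} (hα : 0 < α) (t a b : ℝ) :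
    IntervalIntegrable (fun r : ℝ => (t - r) ^ (α - 1)) volume a b := by
  have h := (intervalIntegral.intervalIntegrable_rpow' (r := α - 1) (by linarith)
    (a := t - a) (b := t - b)).comp_sub_left t
  simpa using h

/-- The function `t ↦ E_α(-t^α)` solves a Volterra equation with an Abel kernel. -/
lemma integral_mittagLeffler_mul_sub_rpow {α t : ℝ} (hα : 0 < α) (ht : 0 < t) :
    ∫ r in (0:ℝ)..t, mittagLeffler α (-(r ^ α)) * (t - r) ^ (α - 1) =
      Real.Gamma α * (1 - mittagLeffler α (-(t ^ α))) := by
  have hsum : HasSum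
      (fun n : ℕ => ∫ r in (0:ℝ)..t,
        (-(r ^ α)) ^ n / Real.Gamma (α * n + 1) * (t - r) ^ (α - 1))
      (∫ r in (0:ℝ)..t, mittagLeffler α (-(r ^ α)) * (t - r) ^ (α - 1)) := by
    refine intervalIntegral.hasSum_integral_of_dominated_convergence
      (fun n r => (t ^ α) ^ n / Real.Gamma (α * n + 1) * (t - r) ^ (α - 1)) ?_ ?_ ?_ ?_ ?_
    · intro n
      exact (by fun_prop : Measurable fun r : ℝ =>
        (-(r ^ α)) ^ n / Real.Gamma (α * n + 1) * (t - r) ^ (α - 1)).aestronglyMeasurable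
    · refine fun n => ae_of_all _ fun r hr => ?_
      rw [uIoc_of_le ht.le] at hr
      have h0 := hr.1.le
      have h1 := hr.2
      have h2 := (Gamma_pos hα n).le
      have h3 : 0 ≤ (t - r) ^ (α - 1) := Real.rpow_nonneg (sub_nonneg.2 h1) _
      rw [norm_mul, norm_div, norm_pow, norm_neg, Real.norm_of_nonneg h2, Real.norm_of_nonneg h3,
        Real.norm_of_nonneg (Real.rpow_nonneg h0 _)]
      gcongr
    · exact ae_of_all _ fun r _ => (summable_pow_div_Gamma hα _).mul_right _
    · simp_rw [tsum_mul_right]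
      exact (intervalIntegrable_sub_rpow hα t 0 t).const_mul _
    · exact ae_of_all _ fun r _ => (summable_pow_div_Gamma hα _).hasSum.mul_right _
  have hterm : ∀ n : ℕ, ∫ r in (0:ℝ)..t,
      (-(r ^ α)) ^ n / Real.Gamma (α * n + 1) * (t - r) ^ (α - 1) =
      -Real.Gamma α * ((-(t ^ α)) ^ (n + 1) / Real.Gamma (α * (n + 1 : ℕ) + 1)) := by
    intro n
    have hb := integral_rpow_mul_sub_rpow (u := α * n + 1) (by positivity) hα ht
    have hcongr : ∫ r in (0:ℝ)..t,
        (-(r ^ α)) ^ n / Real.Gamma (α * n + 1) * (t - r) ^ (α - 1) =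
        ∫ r in (0:ℝ)..t, (-1) ^ n / Real.Gamma (α * n + 1) *
          (r ^ (α * n + 1 - 1) * (t - r) ^ (α - 1)) := by
      refine intervalIntegral.integral_congr fun r hr => ?_
      rw [uIcc_of_le ht.le] at hr
      rw [add_sub_cancel_right, Real.rpow_mul hr.1, Real.rpow_natCast, neg_pow]
      ring
    have hpow : t ^ (α * n + 1 + α - 1) = (t ^ α) ^ (n + 1) := by
      rw [← Real.rpow_natCast, ← Real.rpow_mul ht.le]
      congr 1
      push_cast
      ring
    have harg : α * n + 1 + α = α * (n + 1 : ℕ) + 1 := by push_cast; ring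
    have := (Gamma_pos hα n).ne'
    rw [hcongr, intervalIntegral.integral_const_mul, hb, hpow, harg, neg_pow (t ^ α)]
    field_simp
    ring
  have hzero : HasSum (fun n : ℕ => (-(t ^ α)) ^ (n + 1) / Real.Gamma (α * (n + 1 : ℕ) + 1))
      (mittagLeffler α (-(t ^ α)) - 1) := by
    have h := (hasSum_nat_add_iff' 1).2 (summable_pow_div_Gamma hα (-(t ^ α))).hasSum
    simpa [mittagLeffler] using h
  simp_rw [hterm] at hsum
  rw [hsum.unique (hzero.mul_left _)]
  ring

lemma sub_rpow_le {α r t T : ℝ} (hα : α < 1) (hr : 0 ≤ r) (hrt : r < t) (htT : t < T) :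
    (T - r) ^ (α - 1) ≤ (t / T) ^ (1 - α) * (t - r) ^ (α - 1) := by
  have ht : 0 < t := hr.trans_lt hrt
  have hT : 0 < T := ht.trans htT
  have h1 : 0 < t - r := sub_pos.2 hrt
  have h2 : 0 < T - r := by linarith
  rw [← neg_sub 1 α, Real.rpow_neg h1.le, Real.rpow_neg h2.le, ← Real.inv_rpow h1.le,
    ← Real.inv_rpow h2.le, ← Real.mul_rpow (by positivity) (by positivity)]
  refine Real.rpow_le_rpow (by positivity) ?_ (by linarith)
  rw [← div_eq_mul_inv, inv_eq_one_div, div_div, div_le_div_iff₀ h2 (by positivity)]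
  nlinarith

/-- Positivity of solutions of the Abel–Volterra equation. -/
lemma pos_of_abel_volterra {α c : ℝ} {f : ℝ → ℝ} (hα0 : 0 < α) (hα1 : α < 1) (hc : 0 < c)
    (hf : Continuous f) (hf0 : 0 < f 0)
    (hvolt : ∀ t, 0 < t → ∫ r in (0:ℝ)..t, f r * (t - r) ^ (α - 1) = c * (1 - f t))
    {t : ℝ} (ht : 0 ≤ t) : 0 < f t := by
  by_contra! hneg
  set S : Set ℝ := {x | 0 ≤ x ∧ f x ≤ 0}
  have hSclosed : IsClosed S := isClosed_Ici.inter (isClosed_le hf continuous_const)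
  have hSbdd : BddBelow S := ⟨0, fun x hx => hx.1⟩
  set T := sInf S
  obtain ⟨hT0, hfT⟩ : T ∈ S := hSclosed.csInf_mem ⟨t, ht, hneg⟩ hSbdd
  have hTpos : 0 < T := hT0.lt_of_ne fun h => by rw [← h] at hfT; linarith
  have hbefore : ∀ x, 0 ≤ x → x < T → 0 < f x := fun x hx hxT => by
    by_contra! h
    exact (csInf_le hSbdd ⟨hx, h⟩).not_gt hxT
  have hlim : ∀ᶠ x in 𝓝 T, (T - x) ^ α / α - c * (x / T) ^ (1 - α) < 0 := by
    have hcont : Continuous fun x : ℝ => (T - x) ^ α / α - c * (x / T) ^ (1 - α) :=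
      (((Real.continuous_rpow_const hα0.le).comp (continuous_const.sub continuous_id)).div_const
        _).sub (continuous_const.mul ((Real.continuous_rpow_const (by linarith)).comp
          (continuous_id.div_const _)))
    refine hcont.continuousAt.eventually_lt continuousAt_const ?_
    simp [hTpos.ne', hα0.ne', hc]
  obtain ⟨ε, hε, hball⟩ := Metric.eventually_nhds_iff.1 hlim
  set a := max (T / 2) (T - ε / 2)
  have ha0 : 0 < a := lt_max_of_lt_left (by linarith)
  have haT : a < T := max_lt (by linarith) (by linarith)
  obtain ⟨x, hx, hmax⟩ := isCompact_Icc.exists_isMaxOn (nonempty_Icc.2 haT.le) hf.continuousOn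
  have hfx : 0 < f x := (hbefore a ha0.le haT).trans_le (hmax (left_mem_Icc.2 haT.le))
  have hxT : x < T := hx.2.lt_of_ne fun h => by rw [h] at hfx; linarith
  have hx0 : 0 < x := ha0.trans_le hx.1
  have hclose := hball (y := x) (by
    rw [Real.dist_eq, abs_lt]
    have := (le_max_right (T / 2) (T - ε / 2)).trans hx.1
    constructor <;> linarith)
  have hint : ∀ s a b, IntervalIntegrable (fun r => f r * (s - r) ^ (α - 1)) volume a b :=
    fun s a b => (intervalIntegrable_sub_rpow hα0 s a b).continuousOn_mul hf.continuousOn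
  have hfirst : ∫ r in (0:ℝ)..x, f r * (T - r) ^ (α - 1) ≤
      (x / T) ^ (1 - α) * (c * (1 - f x)) := by
    rw [← hvolt x hx0, ← intervalIntegral.integral_const_mul]
    refine intervalIntegral.integral_mono_on_of_le_Ioo hx0.le (hint _ _ _)
      ((hint _ _ _).const_mul _) fun r hr => ?_
    have h1 := sub_rpow_le hα1 hr.1.le hr.2 hxT
    have h2 := hbefore r hr.1.le (hr.2.trans hxT)
    nlinarith [mul_le_mul_of_nonneg_left h1 h2.le]
  have hsecond : ∫ r in x..T, f r * (T - r) ^ (α - 1) ≤ f x * ((T - x) ^ α / α) := by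
    have hval : ∫ r in x..T, (T - r) ^ (α - 1) = (T - x) ^ α / α := by
      rw [intervalIntegral.integral_comp_sub_left (fun y => y ^ (α - 1)) T,
        integral_rpow (Or.inl (by linarith))]
      simp [hα0.ne']
    rw [← hval, ← intervalIntegral.integral_const_mul]
    refine intervalIntegral.integral_mono_on hxT.le (hint _ _ _)
      ((intervalIntegrable_sub_rpow hα0 T x T).const_mul _) fun r hr => ?_
    exact mul_le_mul_of_nonneg_right (hmax ⟨hx.1.trans hr.1, hr.2⟩)
      (Real.rpow_nonneg (sub_nonneg.2 hr.2) _)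
  have hsplit := intervalIntegral.integral_add_adjacent_intervals (hint T 0 x) (hint T x T)
  rw [hvolt T hTpos] at hsplit
  have hρ : (x / T) ^ (1 - α) ≤ 1 :=
    Real.rpow_le_one (by positivity) ((div_le_one hTpos).2 hxT.le) (by linarith)
  nlinarith [mul_neg_of_pos_of_neg hfx hclose, mul_nonneg hc.le (sub_nonneg.2 hρ),
    mul_nonneg hc.le (neg_nonneg.2 hfT)]

lemma mittagLeffler_zero (α : ℝ) : mittagLeffler α 0 = 1 := by
  rw [mittagLeffler, tsum_eq_single 0 fun n hn => by simp [hn]]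
  simp

lemma continuous_mittagLeffler_neg_rpow {α : ℝ} (hα : 0 < α) :
    Continuous fun t : ℝ => mittagLeffler α (-(t ^ α)) :=
  (continuous_mittagLeffler hα).comp (Real.continuous_rpow_const hα.le).neg

lemma mittagLeffler_neg_rpow_pos {α t : ℝ} (hα0 : 0 < α) (hα1 : α < 1) (ht : 0 ≤ t) :
    0 < mittagLeffler α (-(t ^ α)) :=
  pos_of_abel_volterra (f := fun t => mittagLeffler α (-(t ^ α))) hα0 hα1
    (Real.Gamma_pos_of_pos hα0) (continuous_mittagLeffler_neg_rpow hα0)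
    (by simp [hα0.ne', mittagLeffler_zero])
    (fun _ ht => integral_mittagLeffler_mul_sub_rpow hα0 ht) ht

lemma mittagLeffler_neg_rpow_le_one {α t : ℝ} (hα0 : 0 < α) (hα1 : α < 1) (ht : 0 < t) :
    mittagLeffler α (-(t ^ α)) ≤ 1 := by
  have h : 0 ≤ ∫ r in (0:ℝ)..t, mittagLeffler α (-(r ^ α)) * (t - r) ^ (α - 1) :=
    intervalIntegral.integral_nonneg ht.le fun r hr =>
      mul_nonneg (mittagLeffler_neg_rpow_pos hα0 hα1 hr.1).le
        (Real.rpow_nonneg (sub_nonneg.2 hr.2) _)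
  rw [integral_mittagLeffler_mul_sub_rpow hα0 ht] at h
  linarith [nonneg_of_mul_nonneg_right h (Real.Gamma_pos_of_pos hα0)]

lemma integrableOn_exp_mul_mittagLeffler {α s : ℝ} (hα0 : 0 < α) (hα1 : α < 1) (hs : 0 < s) :
    IntegrableOn (fun t => Real.exp (-(s * t)) * mittagLeffler α (-(t ^ α))) (Ioi 0) := by
  have hexp : IntegrableOn (fun t : ℝ => Real.exp (-(s * t))) (Ioi 0) := by
    simpa [neg_mul] using exp_neg_integrableOn_Ioi 0 hs
  have hcont := continuous_mittagLeffler_neg_rpow hα0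
  refine Integrable.mono' hexp
    (by fun_prop : Continuous fun t => Real.exp (-(s * t)) *
      mittagLeffler α (-(t ^ α))).aestronglyMeasurable ?_
  filter_upwards [ae_restrict_mem measurableSet_Ioi] with t ht
  have ht' : 0 < t := ht
  rw [Real.norm_of_nonneg (mul_nonneg (Real.exp_pos _).le
    (mittagLeffler_neg_rpow_pos hα0 hα1 ht'.le).le)]
  exact mul_le_of_le_one_right (Real.exp_pos _).le (mittagLeffler_neg_rpow_le_one hα0 hα1 ht')

end MittagLeffler

open MittagLeffler in
/-- For `0 < α < 1` and `s > 0`, the Laplace transform of `Ψ_α(t) = E_α(-t^α)` is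
`s^(α-1) / (s^α + 1)`. -/
theorem laplaceTransform_mittagLeffler
    (α : ℝ) (hα0 : 0 < α) (hα1 : α < 1) :
    ∀ s : ℝ, 0 < s →
      ∫ t in Set.Ioi (0:ℝ), Real.exp (-(s * t)) * mittagLeffler α (-(t ^ α))
        = s ^ (α - 1) / (s ^ α + 1) := by
  intro s hs
  set L := ∫ t in Ioi (0:ℝ), Real.exp (-(s * t)) * mittagLeffler α (-(t ^ α)) with hL
  have hΓ := Real.Gamma_pos_of_pos hα0
  have hψ := integrableOn_exp_mul_mittagLeffler hα0 hα1 hs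
  have hexp : IntegrableOn (fun t : ℝ => Real.exp (-(s * t))) (Ioi 0) := by
    simpa [neg_mul] using exp_neg_integrableOn_Ioi 0 hs
  have hker : IntegrableOn (fun t : ℝ => t ^ (α - 1) * Real.exp (-(s * t))) (Ioi 0) := by
    simpa [neg_mul] using
      integrableOn_rpow_mul_exp_neg_mul_rpow (s := α - 1) (p := 1) (by linarith) one_pos hs
  have hconv := integral_posConvolution hψ hker (ContinuousLinearMap.mul ℝ ℝ)
  simp only [ContinuousLinearMap.mul_apply'] at hconv
  rw [Real.integral_rpow_mul_exp_neg_mul_Ioi hα0 hs, ← hL] at hconv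
  have hleft : ∫ x in Ioi (0:ℝ), ∫ t in (0:ℝ)..x,
      Real.exp (-(s * t)) * mittagLeffler α (-(t ^ α)) *
        ((x - t) ^ (α - 1) * Real.exp (-(s * (x - t)))) = Real.Gamma α * (1 / s - L) := by
    have hinner : ∀ x ∈ Ioi (0:ℝ), ∫ t in (0:ℝ)..x,
        Real.exp (-(s * t)) * mittagLeffler α (-(t ^ α)) *
          ((x - t) ^ (α - 1) * Real.exp (-(s * (x - t)))) =
        Real.Gamma α * (Real.exp (-(s * x)) -
          Real.exp (-(s * x)) * mittagLeffler α (-(x ^ α))) := by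
      intro x hx
      have hcongr : ∀ t : ℝ, Real.exp (-(s * t)) * mittagLeffler α (-(t ^ α)) *
          ((x - t) ^ (α - 1) * Real.exp (-(s * (x - t)))) =
          Real.exp (-(s * x)) * (mittagLeffler α (-(t ^ α)) * (x - t) ^ (α - 1)) := by
        intro t
        rw [show -(s * x) = -(s * t) + -(s * (x - t)) by ring, Real.exp_add]
        ring
      simp_rw [hcongr]
      rw [intervalIntegral.integral_const_mul, integral_mittagLeffler_mul_sub_rpow hα0 hx]
      ring
    rw [setIntegral_congr_fun measurableSet_Ioi hinner, integral_const_mul,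
      integral_sub hexp hψ, ← hL]
    have := integral_exp_mul_Ioi (a := -s) (by linarith) 0
    simp only [neg_mul, mul_zero, Real.exp_zero, neg_div_neg_eq] at this
    rw [this]
  rw [hleft, one_div, Real.inv_rpow hs.le] at hconv
  have hsα : 0 < s ^ α := Real.rpow_pos_of_pos hs _
  have hkey : s⁻¹ - L = L * (s ^ α)⁻¹ := mul_left_cancel₀ hΓ.ne' (by linarith)
  rw [Real.rpow_sub_one hs.ne', eq_div_iff (by positivity)]
  field_simp at hkey ⊢
  linarith
end
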